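/- arXiv:1902.09865 — 5 statements merged into one kernel-verified Lean document; each statement's English description precedes it below -/
import Mathlib

section
/- Let s ≥ 2, n ≥ 1 and 1 ≤ l ≤ n be integers, let F be a field, let S = {0,1,...,s-1}, and let E ⊆ {1,...,n} with |E| = l. Let P be the matrix over F whose rows are indexed by pairs (i,b) with i ∈ E and b a function from {1,...,n}\{i} to S, whose columns are indexed by vectors t ∈ S^n, and whose entry in row (i,b) and column t equals 1 if t agrees with b on every coordinate j ≠ i, and 0 otherwise. Then the rank of P over F equals s^{n-l}·(s^l − (s−1)^l). -/
open Finset in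
/-- Summing against the indicator of the line in direction `i` through `t` sums along that line. -/
lemma sum_line_indicator {ι A F : Type*} [Fintype ι] [DecidableEq ι] [Fintype A] [DecidableEq A]
    [Semiring F] (f : (ι → A) → F) (i : ι) (t : ι → A) :
    ∑ u : ι → A, (if ∀ j : {j : ι // j ≠ i}, u j = t j then (1 : F) else 0) * f u =
      ∑ a, f (Function.update t i a) := by
  simp only [ite_mul, one_mul, zero_mul]
  rw [← sum_filter]
  symm
  refine sum_bij (fun a _ => Function.update t i a) ?_ ?_ ?_ ?_
  · intro a _
    simp +contextual [Function.update_of_ne]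
  · intro a _ b _ h
    simpa using congrFun h i
  · intro u hu
    refine ⟨u i, mem_univ _, ?_⟩
    rw [mem_filter] at hu
    ext j
    by_cases h : j = i
    · subst h; simp
    · simpa [h] using (hu.2 ⟨j, h⟩).symm
  · simp

/-- A function whose sums along all lines in directions of `E` vanish is determined by its values
at the points avoiding `z` on `E`. -/
lemma eq_zero_of_line_sums_eq_zero {ι A F : Type*} [DecidableEq ι] [Fintype A] [DecidableEq A]
    [Semiring F] (E : Finset ι) (z : A) (f : (ι → A) → F)
    (hf : ∀ i ∈ E, ∀ t : ι → A, ∑ a, f (Function.update t i a) = 0)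
    (h0 : ∀ t : ι → A, (∀ i ∈ E, t i ≠ z) → f t = 0) (t : ι → A) : f t = 0 := by
  induction hm : (E.filter (fun i => t i = z)).card using Nat.strong_induction_on generalizing t with
  | _ m ih =>
  by_cases h : ∀ i ∈ E, t i ≠ z
  · exact h0 t h
  · push Not at h
    obtain ⟨i, hi, hz⟩ := h
    have hs := hf i hi t
    rw [Finset.sum_eq_single z ?_ (by simp)] at hs
    · rwa [← hz, Function.update_eq_self] at hs
    · intro a _ ha
      refine ih _ ?_ _ rfl
      rw [← hm]
      apply Finset.card_lt_card
      rw [Finset.ssubset_iff_of_subset]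
      · exact ⟨i, by simp [hi, hz], by simp [ha]⟩
      · intro j hj
        by_cases hji : j = i
        · subst hji; simp [hi, hz]
        · simpa [hji] using hj

/-- Any values prescribed at the points avoiding `z` on `E` extend to a function whose sums along
all lines in directions of `E` vanish. -/
lemma exists_extension_line_sums_eq_zero {ι A F : Type*} [Fintype ι] [DecidableEq ι] [Fintype A]
    [DecidableEq A] [CommRing F] (E : Finset ι) (z : A)
    (g : {t : ι → A // ∀ i ∈ E, t i ≠ z} → F) :
    ∃ f : (ι → A) → F, (∀ i ∈ E, ∀ t : ι → A, ∑ a, f (Function.update t i a) = 0) ∧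
      ∀ t, f t.1 = g t := by
  let c : (ι → A) → ι → A → F := fun u i a =>
    (if a = u i then 1 else 0) - (if i ∈ E ∧ a = z then 1 else 0)
  refine ⟨fun t => ∑ u, g u * ∏ i, c u.1 i (t i), ?_, ?_⟩
  · intro i hi t
    rw [Finset.sum_comm]
    refine Finset.sum_eq_zero fun u _ => ?_
    have key : ∀ a, ∏ j, c u.1 j (Function.update t i a j) =
        c u.1 i a * ∏ j ∈ Finset.univ.erase i, c u.1 j (t j) := by
      intro a
      rw [← Finset.mul_prod_erase _ _ (Finset.mem_univ i), Function.update_self]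
      congr 1
      refine Finset.prod_congr rfl fun j hj => ?_
      rw [Function.update_of_ne (Finset.ne_of_mem_erase hj)]
    simp only [key]
    rw [← Finset.mul_sum, ← Finset.sum_mul]
    simp [c, hi]
  · intro t
    have hc : ∀ u : {t : ι → A // ∀ i ∈ E, t i ≠ z}, ∏ i, c u.1 i (t.1 i) =
        if u = t then 1 else 0 := by
      intro u
      have : ∀ i, c u.1 i (t.1 i) = if t.1 i = u.1 i then 1 else 0 := by
        intro i
        have : ¬ (i ∈ E ∧ t.1 i = z) := fun h => t.2 i h.1 h.2
        simp [c, this]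
      simp only [this]
      split_ifs with h
      · simp [h]
      · have : ∃ i, t.1 i ≠ u.1 i := by
          by_contra! h'
          exact h (Subtype.ext (funext fun i => (h' i).symm))
        obtain ⟨i, hi⟩ := this
        exact Finset.prod_eq_zero (Finset.mem_univ i) (by simp [hi])
    simp [hc]

lemma card_avoiding_on {ι A : Type*} [Fintype ι] [DecidableEq ι] [Fintype A] [DecidableEq A]
    (E : Finset ι) (z : A) :
    Fintype.card {t : ι → A // ∀ i ∈ E, t i ≠ z} =
      Fintype.card A ^ (Fintype.card ι - E.card) * (Fintype.card A - 1) ^ E.card := by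
  have h : (Finset.univ.filter fun t : ι → A => ∀ i ∈ E, t i ≠ z) =
      Fintype.piFinset fun i => if i ∈ E then Finset.univ.erase z else Finset.univ := by
    ext t
    simp only [Finset.mem_filter, Finset.mem_univ, true_and, Fintype.mem_piFinset]
    refine forall_congr' fun i => ?_
    split_ifs with hi <;> simp [hi]
  rw [Fintype.card_subtype, h, Fintype.card_piFinset]
  simp only [apply_ite Finset.card, Finset.prod_ite, Finset.prod_const, Finset.card_univ,
    Finset.card_erase_of_mem (Finset.mem_univ z)]
  rw [mul_comm, Finset.filter_not, Finset.card_sdiff_of_subset (Finset.filter_subset _ _)]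
  simp

/-- The rank of the symbol matrix `P` of the repair scheme with eavesdropped set `E`
(of size `l`) equals `s^(n-l) * (s^l - (s-1)^l)`. -/
theorem symbol_matrix_rank (s n l : ℕ) (hs : 2 ≤ s) (hn : 1 ≤ n) (hl : 1 ≤ l) (hln : l ≤ n)
    (F : Type*) [Field F] (E : Finset (Fin n)) (hE : E.card = l)
    (P : Matrix ((i : {i : Fin n // i ∈ E}) × ({j : Fin n // j ≠ (i : Fin n)} → Fin s))
          (Fin n → Fin s) F)
    (hP : ∀ (i : {i : Fin n // i ∈ E}) (b : {j : Fin n // j ≠ (i : Fin n)} → Fin s)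
        (t : Fin n → Fin s),
        P ⟨i, b⟩ t = if ∀ j : {j : Fin n // j ≠ (i : Fin n)}, t j = b j then 1 else 0) :
    P.rank = s ^ (n - l) * (s ^ l - (s - 1) ^ l) := by

  have : NeZero s := ⟨by omega⟩
  have hker : ∀ f : (Fin n → Fin s) → F, f ∈ LinearMap.ker P.mulVecLin ↔
      ∀ i ∈ E, ∀ t : Fin n → Fin s, ∑ a, f (Function.update t i a) = 0 := by
    intro f
    have hmul : ∀ (i : {i : Fin n // i ∈ E}) (t : Fin n → Fin s),
        P.mulVec f ⟨i, fun j => t j⟩ = ∑ a, f (Function.update t i a) := by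
      intro i t
      rw [← sum_line_indicator]
      simp only [Matrix.mulVec, dotProduct, hP]
    rw [LinearMap.mem_ker, Matrix.mulVecLin_apply]
    constructor
    · intro h i hi t
      rw [← hmul ⟨i, hi⟩ t, h, Pi.zero_apply]
    · intro h
      ext ⟨i, b⟩
      obtain ⟨t, rfl⟩ : ∃ t : Fin n → Fin s, (fun j : {j // j ≠ i.1} => t j) = b :=
        ⟨fun j => if hj : j ≠ i.1 then b ⟨j, hj⟩ else 0, funext fun j => dif_pos j.2⟩
      rw [hmul, h i.1 i.2, Pi.zero_apply]
  let T := {t : Fin n → Fin s // ∀ i ∈ E, t i ≠ 0}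
  let r : LinearMap.ker P.mulVecLin →ₗ[F] (T → F) :=
    (LinearMap.funLeft F F (Subtype.val : T → Fin n → Fin s)) ∘ₗ Submodule.subtype _
  have hr : Function.Bijective r := by
    constructor
    · rw [← LinearMap.ker_eq_bot, LinearMap.ker_eq_bot']
      rintro ⟨f, hf⟩ h
      ext t
      exact eq_zero_of_line_sums_eq_zero E 0 f ((hker f).1 hf)
        (fun t ht => congrFun h ⟨t, ht⟩) t
    · intro g
      obtain ⟨f, hf, hfg⟩ := exists_extension_line_sums_eq_zero E 0 g
      exact ⟨⟨f, (hker f).2 hf⟩, funext hfg⟩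
  have hdim : Module.finrank F (LinearMap.ker P.mulVecLin) = s ^ (n - l) * (s - 1) ^ l := by
    rw [(LinearEquiv.ofBijective r hr).finrank_eq, Module.finrank_fintype_fun_eq_card]
    have hT := card_avoiding_on E (0 : Fin s)
    rw [Fintype.card_fin, Fintype.card_fin, hE] at hT
    convert hT
  have hrank := P.mulVecLin.finrank_range_add_finrank_ker
  rw [hdim, Module.finrank_fintype_fun_eq_card, Fintype.card_fun, Fintype.card_fin,
    Fintype.card_fin] at hrank
  rw [Nat.mul_sub, ← pow_add, Nat.sub_add_cancel hln, Matrix.rank]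
  omega
end

section
/- Let s ≥ 2, n ≥ 1 and 1 ≤ l ≤ n be integers, let F be a field, let S = {0,1,...,s-1}, and let E ⊆ {1,...,n} with |E| = l. The F-vector space of functions c : S^n → F satisfying, for every i ∈ E and every a ∈ S^n, the line-sum condition ∑_{u∈S} c(a(i,u)) = 0, has dimension (s−1)^l · s^{n−l}. -/
section LineSums

variable {ι κ F : Type*} [DecidableEq ι] [Fintype κ] [DecidableEq κ] [Field F]

/-- A function whose line sums in the directions of `E` vanish is zero as soon as it vanishes at
all points whose coordinates in `E` avoid `z`. -/
theorem eq_zero_of_line_sums_eq_zero_s1 (z : κ) (E : Finset ι) (c : (ι → κ) → F)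
    (hc : ∀ i ∈ E, ∀ a : ι → κ, ∑ u, c (Function.update a i u) = 0)
    (h0 : ∀ a : ι → κ, (∀ i ∈ E, a i ≠ z) → c a = 0) : c = 0 := by
  induction E using Finset.induction_on with
  | empty => exact funext fun a => h0 a (by simp)
  | insert i E hi ih =>
    refine ih (fun j hj => hc j (Finset.mem_insert_of_mem hj)) fun a ha => ?_
    by_cases haz : a i = z
    · have hsum := hc i (Finset.mem_insert_self i E) a
      rw [Finset.sum_eq_single z] at hsum
      · rwa [← haz, Function.update_eq_self] at hsum
      · intro u _ hu
        refine h0 _ fun j hj => ?_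
        by_cases hji : j = i
        · subst hji
          simpa using hu
        · rw [Function.update_of_ne hji]
          exact ha j (Finset.mem_of_mem_insert_of_ne hj hji)
      · simp
    · refine h0 a fun j hj => ?_
      rcases Finset.mem_insert.1 hj with rfl | hj
      · exact haz
      · exact ha j hj

/-- Arbitrary values at the points whose coordinates in `E` avoid `z` extend to a function whose
line sums in the directions of `E` vanish. -/
theorem exists_line_sums_eq_zero_extension (z : κ) (E : Finset ι) (f : (ι → κ) → F) :
    ∃ c : (ι → κ) → F, (∀ i ∈ E, ∀ a : ι → κ, ∑ u, c (Function.update a i u) = 0) ∧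
      ∀ a : ι → κ, (∀ i ∈ E, a i ≠ z) → c a = f a := by
  induction E using Finset.induction_on with
  | empty => exact ⟨f, by simp, fun _ _ => rfl⟩
  | insert i E hi ih =>
    obtain ⟨g, hg, hgf⟩ := ih
    refine ⟨fun a => g a - if a i = z then ∑ u, g (Function.update a i u) else 0,
      fun j hj a => ?_, fun a ha => ?_⟩
    · by_cases hji : j = i
      · subst hji
        simp
      · have hjE := Finset.mem_of_mem_insert_of_ne hj hji
        have hij : i ≠ j := Ne.symm hji
        simp only [Finset.sum_sub_distrib, hg j hjE a, Function.update_of_ne hij, zero_sub,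
          neg_eq_zero]
        split_ifs
        · rw [Finset.sum_comm]
          refine Finset.sum_eq_zero fun v _ => ?_
          simp only [Function.update_comm hji]
          exact hg j hjE _
        · simp
    · have haz := ha i (Finset.mem_insert_self i E)
      simp only [haz, if_false, sub_zero]
      exact hgf a fun j hj => ha j (Finset.mem_insert_of_mem hj)

/-- The number of points whose coordinates in `E` avoid `z`. -/
theorem card_piFinset_avoiding [Fintype ι] (z : κ) (E : Finset ι) :
    (Fintype.piFinset fun i => if i ∈ E then Finset.univ.erase z else Finset.univ).card =
      (Fintype.card κ - 1) ^ E.card * Fintype.card κ ^ (Fintype.card ι - E.card) := by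
  rw [Fintype.card_piFinset]
  simp only [apply_ite Finset.card, Finset.card_erase_of_mem (Finset.mem_univ z),
    Finset.card_univ]
  rw [Finset.prod_ite, Finset.prod_const, Finset.prod_const, Finset.filter_not]
  simp [← Finset.compl_eq_univ_sdiff, Finset.card_compl]

end LineSums

/-- The space of functions `c : S^n → F` whose sums along every axis-parallel line in a
direction `i ∈ E` vanish has dimension `(s-1)^l * s^(n-l)`. -/
theorem kernel_dimension (s n l : ℕ) (hs : 2 ≤ s) (hn : 1 ≤ n) (hl : 1 ≤ l) (hln : l ≤ n)
    (F : Type*) [Field F] (E : Finset (Fin n)) (hE : E.card = l)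
    (W : Submodule F ((Fin n → Fin s) → F))
    (hW : ∀ c : (Fin n → Fin s) → F,
        c ∈ W ↔ ∀ i ∈ E, ∀ a : Fin n → Fin s,
          ∑ u : Fin s, c (Function.update a i u) = 0) :
    Module.finrank F W = (s - 1) ^ l * s ^ (n - l) := by
  subst hE
  let z : Fin s := ⟨0, by omega⟩
  let T : Finset (Fin n → Fin s) :=
    Fintype.piFinset fun i => if i ∈ E then Finset.univ.erase z else Finset.univ
  have hT : ∀ a, a ∈ T ↔ ∀ i ∈ E, a i ≠ z := by
    intro a
    simp only [T, Fintype.mem_piFinset]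
    refine forall_congr' fun i => ?_
    by_cases hi : i ∈ E <;> simp [hi]
  let r : W →ₗ[F] (T → F) := (LinearMap.funLeft F F ((↑) : T → Fin n → Fin s)).comp W.subtype
  have hr : Function.Bijective r := by
    constructor
    · rw [injective_iff_map_eq_zero]
      intro c hc
      refine Submodule.coe_eq_zero.1 <|
        eq_zero_of_line_sums_eq_zero_s1 z E c.1 ((hW c).1 c.2) fun a ha => ?_
      exact congrFun hc ⟨a, (hT a).2 ha⟩
    · intro f
      obtain ⟨c, hc, hcf⟩ := exists_line_sums_eq_zero_extension z E
        fun a => if h : a ∈ T then f ⟨a, h⟩ else 0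
      refine ⟨⟨c, (hW c).2 hc⟩, funext fun a => ?_⟩
      exact (hcf a ((hT a).1 a.2)).trans (dif_pos a.2)
  rw [(LinearEquiv.ofBijective r hr).finrank_eq, Module.finrank_fintype_fun_eq_card,
    Fintype.card_coe, card_piFinset_avoiding]
  simp
end

section
/- Let s ≥ 2 and l ≥ 1 be integers, let F be a field, and let S = {0,1,...,s-1}. Let H be the matrix over F whose rows are indexed by pairs (i,r) with i ∈ {1,...,l} and r a function from {1,...,l}\{i} to S, whose columns are indexed by vectors t ∈ S^l, and whose entry in row (i,r) and column t equals 1 if t agrees with r on every coordinate j ≠ i, and 0 otherwise. Then the rank of H over F equals s^l − (s−1)^l. -/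
/-- The functions on the grid `ι → Fin (n + 1)` whose sum along every axis-parallel line is
zero. -/
def gridLineKernel (ι F : Type*) [DecidableEq ι] [Field F] (n : ℕ) :
    Submodule F ((ι → Fin (n + 1)) → F) where
  carrier := {x | ∀ t i, ∑ a, x (Function.update t i a) = 0}
  add_mem' hx hy t i := by simp [Finset.sum_add_distrib, hx t i, hy t i]
  zero_mem' t i := by simp
  smul_mem' c x hx t i := by simp [← Finset.mul_sum, hx t i]

/-- The matrix of the isomorphism from `Fin n → F` onto the single parity check code of length
`n + 1`: the last coordinate is minus the sum of the others. -/
def parityExtension (F : Type*) [Field F] {n : ℕ} (a : Fin (n + 1)) (b : Fin n) : F :=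
  Fin.lastCases (-1) (fun a' => if a' = b then 1 else 0) a

theorem sum_parityExtension (F : Type*) [Field F] {n : ℕ} (b : Fin n) :
    ∑ a, parityExtension F a b = 0 := by
  simp [Fin.sum_univ_castSucc, parityExtension]

/-- The linear extension of a function on the subgrid `ι → Fin n` to the grid
`ι → Fin (n + 1)` with zero sum along every line. -/
def gridExtension (ι F : Type*) [Fintype ι] [DecidableEq ι] [Field F] (n : ℕ) :
    ((ι → Fin n) → F) →ₗ[F] ((ι → Fin (n + 1)) → F) :=
  Matrix.mulVecLin (Matrix.of fun t u => ∏ i, parityExtension F (t i) (u i))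

section

variable {ι F : Type*} [Fintype ι] [DecidableEq ι] [Field F] {n : ℕ}

theorem gridExtension_apply (y : (ι → Fin n) → F) (t : ι → Fin (n + 1)) :
    gridExtension ι F n y t = ∑ u, (∏ i, parityExtension F (t i) (u i)) * y u := rfl

theorem gridExtension_mem (y : (ι → Fin n) → F) :
    gridExtension ι F n y ∈ gridLineKernel ι F n := by
  intro t i
  simp only [gridExtension_apply]
  rw [Finset.sum_comm]
  refine Finset.sum_eq_zero fun u _ => ?_
  rw [← Finset.sum_mul]
  have key (a : Fin (n + 1)) : ∏ j, parityExtension F (Function.update t i a j) (u j) =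
      parityExtension F a (u i) * ∏ j ∈ Finset.univ.erase i, parityExtension F (t j) (u j) := by
    rw [← Finset.mul_prod_erase _ _ (Finset.mem_univ i), Function.update_self]
    congr 1
    refine Finset.prod_congr rfl fun j hj => ?_
    rw [Function.update_of_ne (Finset.ne_of_mem_erase hj)]
  simp only [key]
  rw [← Finset.sum_mul, sum_parityExtension, zero_mul, zero_mul]

theorem gridExtension_castSucc (y : (ι → Fin n) → F) (u : ι → Fin n) :
    gridExtension ι F n y (fun i => (u i).castSucc) = y u := by
  have key (v : ι → Fin n) :
      ∏ i, parityExtension F (u i).castSucc (v i) = if u = v then 1 else 0 := by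
    simp [parityExtension, Finset.prod_ite_zero, funext_iff]
  simp [gridExtension_apply, key]

theorem eq_zero_of_mem_gridLineKernel {x : (ι → Fin (n + 1)) → F}
    (hx : x ∈ gridLineKernel ι F n) (h : ∀ u : ι → Fin n, x (fun i => (u i).castSucc) = 0) :
    x = 0 := by
  suffices ∀ (A : Finset ι) (t : ι → Fin (n + 1)), (∀ i ∉ A, t i ≠ Fin.last n) → x t = 0 from
    funext fun t => this Finset.univ t (by simp)
  intro A
  induction A using Finset.induction_on with
  | empty =>
    intro t ht
    simpa using h fun i => (t i).castPred (ht i (by simp))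
  | insert i A _ ih =>
    intro t ht
    have hc (a : Fin n) : x (Function.update t i a.castSucc) = 0 := by
      refine ih _ fun j hj => ?_
      by_cases hji : j = i
      · subst hji
        simp [Fin.castSucc_ne_last]
      · simpa [hji] using ht j (by simp [hji, hj])
    have hl : x (Function.update t i (Fin.last n)) = 0 := by
      simpa [Fin.sum_univ_castSucc, hc] using hx t i
    cases hti : t i using Fin.lastCases with
    | last => rwa [← hti, Function.update_eq_self] at hl
    | cast a => simpa [← hti] using hc a

theorem range_gridExtension :
    LinearMap.range (gridExtension ι F n) = gridLineKernel ι F n := by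
  refine le_antisymm ?_ fun x hx => ?_
  · rintro _ ⟨y, rfl⟩
    exact gridExtension_mem y
  · refine ⟨fun u => x fun i => (u i).castSucc, sub_eq_zero.mp ?_⟩
    exact eq_zero_of_mem_gridLineKernel (Submodule.sub_mem _ (gridExtension_mem _) hx)
      fun u => by simp [gridExtension_castSucc]

theorem finrank_gridLineKernel :
    Module.finrank F (gridLineKernel ι F n) = n ^ Fintype.card ι := by
  have hinj : Function.Injective (gridExtension ι F n) := fun y z hyz => by
    funext u
    rw [← gridExtension_castSucc y u, hyz, gridExtension_castSucc]
  rw [← range_gridExtension, LinearMap.finrank_range_of_inj hinj]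
  simp

theorem sum_ite_agree_off_mul (x : (ι → Fin (n + 1)) → F) (t : ι → Fin (n + 1)) (i : ι) :
    ∑ t', (if ∀ j : {j // j ≠ i}, t' j = t j then 1 else 0) * x t' =
      ∑ a, x (Function.update t i a) := by
  simp only [ite_mul, one_mul, zero_mul]
  rw [← Finset.sum_filter]
  refine Finset.sum_nbij' (fun t' => t' i) (fun a => Function.update t i a) ?_ ?_ ?_ ?_ ?_
  · simp
  · intro a _
    simp only [Finset.mem_filter, Finset.mem_univ, true_and]
    exact fun j => Function.update_of_ne j.2 _ _
  · intro t' ht'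
    simp only [Finset.mem_filter, Finset.mem_univ, true_and] at ht'
    exact Function.update_eq_iff.mpr ⟨rfl, fun j hj => (ht' ⟨j, hj⟩).symm⟩
  · simp
  · intro t' ht'
    simp only [Finset.mem_filter, Finset.mem_univ, true_and] at ht'
    exact congrArg x (Function.update_eq_iff.mpr ⟨rfl, fun j hj => (ht' ⟨j, hj⟩).symm⟩).symm

end


/-- The parity check matrix `H` of the `l`-fold direct product of the single parity check
code of length `s` (equivalently, the transpose of the incidence matrix of the grid
hypergraph `G_{s,l}`) has rank `s^l - (s-1)^l`. -/
theorem incidence_matrix_rank (s l : ℕ) (hs : 2 ≤ s) (hl : 1 ≤ l)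
    (F : Type*) [Field F]
    (H : Matrix ((i : Fin l) × ({j : Fin l // j ≠ i} → Fin s)) (Fin l → Fin s) F)
    (hH : ∀ (i : Fin l) (r : {j : Fin l // j ≠ i} → Fin s) (t : Fin l → Fin s),
        H ⟨i, r⟩ t = if ∀ j : {j : Fin l // j ≠ i}, t j = r j then 1 else 0) :
    H.rank = s ^ l - (s - 1) ^ l := by
  obtain ⟨n, rfl⟩ : ∃ n, s = n + 1 := ⟨s - 1, by omega⟩
  have hker : LinearMap.ker H.mulVecLin = gridLineKernel (Fin l) F n := by
    ext x
    rw [LinearMap.mem_ker, Matrix.mulVecLin_apply, funext_iff]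
    constructor
    · intro hx t i
      rw [← sum_ite_agree_off_mul]
      simpa only [Matrix.mulVec, dotProduct, hH, Pi.zero_apply] using hx ⟨i, fun j => t j⟩
    · rintro hx ⟨i, r⟩
      let t : Fin l → Fin (n + 1) := fun j => if hj : j ≠ i then r ⟨j, hj⟩ else 0
      have hr : r = fun j : {j // j ≠ i} => t j := by
        funext j
        simp [t, j.2]
      have hsum := hx t i
      rw [← sum_ite_agree_off_mul] at hsum
      simpa only [Matrix.mulVec, dotProduct, hH, hr, Pi.zero_apply] using hsum
  have hdim := LinearMap.finrank_range_add_finrank_ker H.mulVecLin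
  rw [hker, finrank_gridLineKernel] at hdim
  simp only [Module.finrank_fintype_fun_eq_card, Fintype.card_fun, Fintype.card_fin] at hdim
  rw [Matrix.rank, Nat.add_sub_cancel]
  exact Nat.eq_sub_of_add_eq hdim
end

section
/- Let s ≥ 2 and l ≥ 1 be integers, let F be a field, and let S = {0,1,...,s-1}. The F-vector space of functions c : S^l → F satisfying, for every i ∈ {1,...,l} and every t ∈ S^l, the condition ∑_{u∈S} c(t(i,u)) = 0, is equal to the linear span of the product functions t ↦ ∏_{i=1}^{l} g_i(t(i)), taken over all choices of functions g_1,...,g_l : S → F each satisfying ∑_{u∈S} g_i(u) = 0. -/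
/-- If all line sums of `c` in direction `j` vanish, then `c` is orthogonal to every function
that does not depend on the `j`-th coordinate. -/
theorem sum_mul_eq_zero_of_line_sums {ι α R : Type*} [Fintype ι] [DecidableEq ι] [Fintype α]
    [CommRing R] (c h : (ι → α) → R) (j : ι)
    (hc : ∀ t : ι → α, ∑ u, c (Function.update t j u) = 0)
    (hh : ∀ (t : ι → α) (u : α), h (Function.update t j u) = h t) :
    ∑ v, c v * h v = 0 := by
  rw [← (Equiv.funSplitAt j α).symm.sum_comp, Fintype.sum_prod_type_right]
  refine Finset.sum_eq_zero fun r _ => ?_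
  rcases isEmpty_or_nonempty α with hα | ⟨⟨a⟩⟩
  · simp
  have key (u : α) : (Equiv.funSplitAt j α).symm (u, r) =
      Function.update ((Equiv.funSplitAt j α).symm (a, r)) j u := by
    ext k
    by_cases hk : k = j
    · subst hk; simp [Equiv.funSplitAt, Equiv.piSplitAt]
    · simp [Equiv.funSplitAt, Equiv.piSplitAt, hk]
  rw [Finset.sum_congr rfl fun u _ => by rw [key u, hh], ← Finset.sum_mul, hc, zero_mul]

/-- A function with vanishing line sums is a combination of products of differences of
indicator functions. -/
theorem eq_sum_mul_prod_sub_of_line_sums {ι α R : Type*} [Fintype ι] [DecidableEq ι]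
    [Fintype α] [DecidableEq α] [CommRing R] (c : (ι → α) → R) (a : α)
    (hc : ∀ (i : ι) (t : ι → α), ∑ u, c (Function.update t i u) = 0) (t : ι → α) :
    c t = ∑ v, c v * ∏ i, ((if t i = v i then 1 else 0) - (if t i = a then 1 else 0)) := by
  simp_rw [sub_eq_add_neg, Finset.prod_add, Finset.mul_sum]
  rw [Finset.sum_comm, Finset.sum_eq_single_of_mem Finset.univ (by simp)]
  · simp [Finset.prod_ite_zero, ← funext_iff]
  · intro A _ hA
    obtain ⟨j, hj⟩ : ∃ j, j ∉ A := by
      simpa [Finset.eq_univ_iff_forall] using hA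
    refine sum_mul_eq_zero_of_line_sums c _ j (hc j) fun v u => ?_
    congr 1
    refine Finset.prod_congr rfl fun i hi => ?_
    rw [Function.update_of_ne (ne_of_mem_of_not_mem hi hj)]

/-- The space of functions `c : S^l → F` all of whose axis-parallel line sums vanish equals
the span of the product functions `t ↦ ∏ i, g i (t i)` built from functions
`g i : S → F` with zero sum, i.e. the `l`-fold direct (tensor) product of the single
parity check code of length `s`. -/
theorem product_code_span (s l : ℕ) (hs : 2 ≤ s) (hl : 1 ≤ l)
    (F : Type*) [Field F]
    (W : Submodule F ((Fin l → Fin s) → F))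
    (hW : ∀ c : (Fin l → Fin s) → F,
        c ∈ W ↔ ∀ (i : Fin l) (t : Fin l → Fin s),
          ∑ u : Fin s, c (Function.update t i u) = 0) :
    W = Submodule.span F {f : (Fin l → Fin s) → F |
        ∃ g : Fin l → Fin s → F,
          (∀ i : Fin l, ∑ u : Fin s, g i u = 0) ∧
          f = fun t => ∏ i : Fin l, g i (t i)} := by
  have : NeZero s := ⟨by omega⟩
  apply le_antisymm
  · intro c hc
    rw [hW] at hc
    have hsum : c = ∑ v : Fin l → Fin s, c v • fun t : Fin l → Fin s =>
        ∏ i, ((if t i = v i then (1 : F) else 0) - (if t i = 0 then 1 else 0)) := by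
      ext t
      simpa using eq_sum_mul_prod_sub_of_line_sums c 0 hc t
    rw [hsum]
    refine Submodule.sum_mem _ fun v _ => Submodule.smul_mem _ _ (Submodule.subset_span ?_)
    exact ⟨fun i x => (if x = v i then 1 else 0) - (if x = 0 then 1 else 0),
      fun i => by simp, rfl⟩
  · rw [Submodule.span_le]
    rintro _ ⟨g, hg, rfl⟩
    refine (hW _).2 fun i t => ?_
    have key (u : Fin s) : ∏ k, g k (Function.update t i u k) =
        g i u * ∏ k ∈ Finset.univ.erase i, g k (t k) := by
      rw [← Finset.mul_prod_erase _ _ (Finset.mem_univ i), Function.update_self]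
      congr 1
      refine Finset.prod_congr rfl fun k hk => ?_
      rw [Function.update_of_ne (Finset.ne_of_mem_erase hk)]
    simp_rw [key, ← Finset.sum_mul, hg, zero_mul]
end

section
/- Let s ≥ 2, n ≥ 1 and 1 ≤ l ≤ n be integers, let F be a field, let S = {0,1,...,s-1}, and let E ⊆ {1,...,n} with |E| = l. Let P be the matrix over F whose rows are indexed by pairs (i,b) with i ∈ E and b a function from {1,...,n}\{i} to S, whose columns are indexed by t ∈ S^n, with entry 1 in row (i,b) and column t if t agrees with b on every coordinate j ≠ i, and 0 otherwise. Let H be the matrix over F whose rows are indexed by pairs (i,r) with i ∈ {1,...,l} and r a function from {1,...,l}\{i} to S, whose columns are indexed by t ∈ S^l, with entry 1 in row (i,r) and column t if t agrees with r on every coordinate j ≠ i, and 0 otherwise. Then rank(P) = s^{n−l} · rank(H). -/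
open Matrix in
/-- If, up to a bijection of the columns and repetition of rows, `A` is block diagonal with every
block equal to `B`, then its rank is the number of blocks times the rank of `B`. -/
theorem Matrix.rank_eq_card_mul_rank_of_blocks {F m n m' q o : Type*} [Field F] [Fintype n]
    [Fintype q] [Fintype o] [DecidableEq o] (A : Matrix m' q F) (B : Matrix m n F)
    (ρ : m' → m × o) (hρ : Function.Surjective ρ) (e : q ≃ n × o)
    (h : ∀ a t, A a t = if (ρ a).2 = (e t).2 then B (ρ a).1 (e t).1 else 0) :
    A.rank = Fintype.card o * B.rank := by
  have hmul : ∀ (x : q → F) (a : m'),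
      (A *ᵥ x) a = (B *ᵥ fun j => x (e.symm (j, (ρ a).2))) (ρ a).1 := by
    intro x a
    simp only [mulVec, dotProduct]
    rw [← e.symm.sum_comp, Fintype.sum_prod_type]
    simp [h]
  have hker : ∀ x : q → F, x ∈ A.mulVecLin.ker ↔
      ∀ k, (fun j => x (e.symm (j, k))) ∈ B.mulVecLin.ker := by
    intro x
    simp only [LinearMap.mem_ker, mulVecLin_apply]
    constructor
    · intro hx k
      funext i
      obtain ⟨a, ha⟩ := hρ (i, k)
      have := congrFun hx a
      rw [hmul, ha] at this
      exact this
    · intro hx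
      funext a
      rw [hmul, hx]
      rfl
  let φ : A.mulVecLin.ker ≃ₗ[F] (o → B.mulVecLin.ker) :=
    { toFun := fun x k => ⟨fun j => x.1 (e.symm (j, k)), (hker x.1).1 x.2 k⟩
      map_add' := fun _ _ => rfl
      map_smul' := fun _ _ => rfl
      invFun := fun y => ⟨fun t => (y (e t).2).1 (e t).1, (hker _).2 fun k => by simp⟩
      left_inv := fun x => by ext t; simp
      right_inv := fun y => by ext k j; simp }
  have hA := A.mulVecLin.finrank_range_add_finrank_ker
  have hB := B.mulVecLin.finrank_range_add_finrank_ker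
  rw [φ.finrank_eq, Module.finrank_pi_fintype, Module.finrank_fintype_fun_eq_card,
    Fintype.card_congr e, Fintype.card_prod] at hA
  rw [Module.finrank_fintype_fun_eq_card] at hB
  simp only [Finset.sum_const, Finset.card_univ, smul_eq_mul] at hA
  rw [← hB] at hA
  unfold Matrix.rank
  linarith

/-- The rank of the symbol matrix `P` (for the eavesdropped coordinate set `E` of size `l`)
equals `s^(n-l)` times the rank of the incidence matrix `H` of the grid hypergraph
`G_{s,l}`. -/
theorem symbol_matrix_rank_factorization (s n l : ℕ) (hs : 2 ≤ s) (hn : 1 ≤ n) (hl : 1 ≤ l)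
    (hln : l ≤ n) (F : Type*) [Field F] (E : Finset (Fin n)) (hE : E.card = l)
    (P : Matrix ((i : {i : Fin n // i ∈ E}) × ({j : Fin n // j ≠ (i : Fin n)} → Fin s))
          (Fin n → Fin s) F)
    (hP : ∀ (i : {i : Fin n // i ∈ E}) (b : {j : Fin n // j ≠ (i : Fin n)} → Fin s)
        (t : Fin n → Fin s),
        P ⟨i, b⟩ t = if ∀ j : {j : Fin n // j ≠ (i : Fin n)}, t j = b j then 1 else 0)
    (H : Matrix ((i : Fin l) × ({j : Fin l // j ≠ i} → Fin s)) (Fin l → Fin s) F)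
    (hH : ∀ (i : Fin l) (r : {j : Fin l // j ≠ i} → Fin s) (t : Fin l → Fin s),
        H ⟨i, r⟩ t = if ∀ j : {j : Fin l // j ≠ i}, t j = r j then 1 else 0) :
    P.rank = s ^ (n - l) * H.rank := by
  classical
  let g : {i : Fin n // i ∈ E} ≃ Fin l := E.equivFinOfCardEq hE
  let e : (Fin n → Fin s) ≃ (Fin l → Fin s) × ({j : Fin n // j ∉ E} → Fin s) :=
    (Equiv.piEquivPiSubtypeProd (· ∈ E) fun _ => Fin s).trans
      ((Equiv.arrowCongr g (Equiv.refl _)).prodCongr (Equiv.refl _))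
  have he : ∀ t j, (e t).1 j = t (g.symm j) := fun _ _ => rfl
  have hg : ∀ (i : {i : Fin n // i ∈ E}) (j : Fin l), j ≠ g i → (g.symm j : Fin n) ≠ i := by
    intro i j hj h
    exact hj ((Equiv.symm_apply_eq g).1 (Subtype.ext h))
  let ρ : ((i : {i : Fin n // i ∈ E}) × ({j : Fin n // j ≠ (i : Fin n)} → Fin s)) →
      ((i : Fin l) × ({j : Fin l // j ≠ i} → Fin s)) × ({j : Fin n // j ∉ E} → Fin s) :=
    fun a => (⟨g a.1, fun j => a.2 ⟨g.symm j, hg a.1 j j.2⟩⟩,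
      fun j => a.2 ⟨j, fun h => j.2 (h ▸ a.1.2)⟩)
  have hρ : Function.Surjective ρ := by
    rintro ⟨⟨i, r⟩, u⟩
    obtain ⟨i, rfl⟩ := g.surjective i
    refine ⟨⟨i, fun j => if hj : (j : Fin n) ∈ E then
      r ⟨g ⟨j, hj⟩, fun h => j.2 (congrArg Subtype.val (g.injective h))⟩ else u ⟨j, hj⟩⟩, ?_⟩
    refine Prod.ext (Sigma.ext rfl (heq_of_eq ?_)) ?_
    · funext j
      simp [ρ]
    · funext j
      simp [ρ, j.2]
  rw [P.rank_eq_card_mul_rank_of_blocks H ρ hρ e]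
  · simp [Fintype.card_subtype_compl, hE]
  · rintro ⟨i, b⟩ t
    rw [hP, hH, ← ite_and]
    refine if_congr ⟨fun h => ⟨?_, fun j => h ⟨g.symm j, _⟩⟩, ?_⟩ rfl rfl
    · funext j
      exact (h ⟨j, _⟩).symm
    · rintro ⟨h2, h1⟩ ⟨j, hj⟩
      by_cases hjE : j ∈ E
      · have := h1 ⟨g ⟨j, hjE⟩, fun h => hj (congrArg Subtype.val (g.injective h))⟩
        simpa [he] using this
      · exact (congrFun h2 ⟨j, hjE⟩).symm
end
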